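/- arXiv:0808.1749 — 4 statements merged into one kernel-verified Lean document; each statement's English description precedes it below -/
import Mathlib

section
/- Let n ≥ 2 and let p̄ and q̄ be two n-perversities. Suppose there exists an n-perversity r̄ with p̄(κ) + q̄(κ) ≤ r̄(κ) for all 2 ≤ κ ≤ n. Then there exists a unique minimal n-perversity s̄ such that p̄(κ) + q̄(κ) ≤ s̄(κ) for all 2 ≤ κ ≤ n; that is, s̄ is an n-perversity with p̄ + q̄ ≤ s̄ pointwise, and for every n-perversity r̄ with p̄(κ) + q̄(κ) ≤ r̄(κ) for all 2 ≤ κ ≤ n one has s̄(κ) ≤ r̄(κ) for all 2 ≤ κ ≤ n. -/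
/-- An `n`-perversity: a function on `{2, …, n}` (modeled as `ℕ → ℕ`, with conditions imposed
only on that range) with `p 2 = 0` and `p κ ≤ p (κ+1) ≤ p κ + 1` for `2 ≤ κ ≤ n - 1`. -/
def IsPerversity (n : ℕ) (p : ℕ → ℕ) : Prop :=
  p 2 = 0 ∧ ∀ κ, 2 ≤ κ → κ + 1 ≤ n → p κ ≤ p (κ + 1) ∧ p (κ + 1) ≤ p κ + 1

/-- The pointwise infimum of a nonempty family of `n`-perversities is an `n`-perversity. -/
theorem IsPerversity.sInf_image {n : ℕ} {S : Set (ℕ → ℕ)} (hS : S.Nonempty)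
    (hper : ∀ r ∈ S, IsPerversity n r) :
    IsPerversity n fun κ => sInf ((fun r => r κ) '' S) := by
  have le {r : ℕ → ℕ} (hr : r ∈ S) (κ : ℕ) : sInf ((fun r => r κ) '' S) ≤ r κ :=
    Nat.sInf_le ⟨r, hr, rfl⟩
  have attained (κ : ℕ) : ∃ r ∈ S, r κ = sInf ((fun r => r κ) '' S) :=
    Nat.sInf_mem (hS.image _)
  refine ⟨?_, fun κ h2 hκ => ⟨?_, ?_⟩⟩
  · obtain ⟨r, hr⟩ := hS
    exact Nat.le_zero.mp ((le hr 2).trans (hper r hr).1.le)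
  · obtain ⟨r, hr, heq⟩ := attained (κ + 1)
    exact (le hr κ).trans (((hper r hr).2 κ h2 hκ).1.trans heq.le)
  · obtain ⟨r, hr, heq⟩ := attained κ
    exact (le hr (κ + 1)).trans
      (((hper r hr).2 κ h2 hκ).2.trans (Nat.add_le_add_right heq.le 1))

/-- If some `n`-perversity dominates `p̄ + q̄` pointwise on `{2,…,n}`, then there is a unique
minimal `n`-perversity `s̄` dominating `p̄ + q̄` (uniqueness as functions on `{2,…,n}`). -/
theorem exists_unique_minimal_perversity (n : ℕ) (hn : 2 ≤ n) (p q : ℕ → ℕ)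
    (hp : IsPerversity n p) (hq : IsPerversity n q)
    (h : ∃ r, IsPerversity n r ∧ ∀ κ, 2 ≤ κ → κ ≤ n → p κ + q κ ≤ r κ) :
    ∃ s, (IsPerversity n s ∧ (∀ κ, 2 ≤ κ → κ ≤ n → p κ + q κ ≤ s κ) ∧
        (∀ r, IsPerversity n r → (∀ κ, 2 ≤ κ → κ ≤ n → p κ + q κ ≤ r κ) →
          ∀ κ, 2 ≤ κ → κ ≤ n → s κ ≤ r κ)) ∧
      ∀ s', (IsPerversity n s' ∧ (∀ κ, 2 ≤ κ → κ ≤ n → p κ + q κ ≤ s' κ) ∧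
        (∀ r, IsPerversity n r → (∀ κ, 2 ≤ κ → κ ≤ n → p κ + q κ ≤ r κ) →
          ∀ κ, 2 ≤ κ → κ ≤ n → s' κ ≤ r κ)) →
        ∀ κ, 2 ≤ κ → κ ≤ n → s' κ = s κ := by
  let S : Set (ℕ → ℕ) :=
    {r | IsPerversity n r ∧ ∀ κ, 2 ≤ κ → κ ≤ n → p κ + q κ ≤ r κ}
  have hS : S.Nonempty := h
  have hper := IsPerversity.sInf_image hS fun r hr => hr.1
  have hdom : ∀ κ, 2 ≤ κ → κ ≤ n → p κ + q κ ≤ sInf ((fun r => r κ) '' S) := by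
    intro κ h2 hκ
    refine le_csInf (hS.image _) ?_
    rintro _ ⟨r, hr, rfl⟩
    exact hr.2 κ h2 hκ
  have hmin : ∀ r, IsPerversity n r → (∀ κ, 2 ≤ κ → κ ≤ n → p κ + q κ ≤ r κ) →
      ∀ κ, 2 ≤ κ → κ ≤ n → sInf ((fun r => r κ) '' S) ≤ r κ :=
    fun r hr hle κ _ _ => Nat.sInf_le ⟨r, ⟨hr, hle⟩, rfl⟩
  refine ⟨_, ⟨hper, hdom, hmin⟩, ?_⟩
  rintro s' ⟨hper', hdom', hmin'⟩ κ h2 hκ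
  exact le_antisymm (hmin' _ hper hdom κ h2 hκ) (hmin s' hper' hdom' κ h2 hκ)
end

section
/- Let n ≥ 2 and let p̄ and q̄ be two n-perversities such that there exists an n-perversity r̄ with p̄(κ) + q̄(κ) ≤ r̄(κ) for all 2 ≤ κ ≤ n. Define s̄ : {2,…,n} → ℤ≥0 by downward recursion: s̄(n) = p̄(n) + q̄(n), and for 2 ≤ κ ≤ n−1, s̄(κ) = max(s̄(κ+1) − 1, p̄(κ) + q̄(κ)). Then: (i) s̄ is an n-perversity (in particular s̄(2) = 0 and s̄(κ) ≤ s̄(κ+1) ≤ s̄(κ)+1 for all κ); (ii) p̄(κ) + q̄(κ) ≤ s̄(κ) for all 2 ≤ κ ≤ n; and (iii) for every n-perversity r̄ with p̄(κ) + q̄(κ) ≤ r̄(κ) for all κ, one has s̄(κ) ≤ r̄(κ) for all 2 ≤ κ ≤ n. -/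
/-- If `s` is defined by the downward recursion `s n = p n + q n`,
`s κ = max (s (κ+1) - 1) (p κ + q κ)` for `2 ≤ κ ≤ n - 1`, and some `n`-perversity dominates
`p + q` pointwise on `{2,…,n}`, then `s` is the minimal `n`-perversity dominating `p + q`. -/
theorem minimal_perversity_recursion (n : ℕ) (hn : 2 ≤ n) (p q : ℕ → ℕ)
    (hp : IsPerversity n p) (hq : IsPerversity n q)
    (h : ∃ r, IsPerversity n r ∧ ∀ κ, 2 ≤ κ → κ ≤ n → p κ + q κ ≤ r κ)
    (s : ℕ → ℕ) (hsn : s n = p n + q n)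
    (hsrec : ∀ κ, 2 ≤ κ → κ + 1 ≤ n → s κ = max (s (κ + 1) - 1) (p κ + q κ)) :
    IsPerversity n s ∧ (∀ κ, 2 ≤ κ → κ ≤ n → p κ + q κ ≤ s κ) ∧
      ∀ r, IsPerversity n r → (∀ κ, 2 ≤ κ → κ ≤ n → p κ + q κ ≤ r κ) →
        ∀ κ, 2 ≤ κ → κ ≤ n → s κ ≤ r κ := by
  have dom : ∀ κ, 2 ≤ κ → κ ≤ n → p κ + q κ ≤ s κ := by
    intro κ h2 hκ
    rcases hκ.eq_or_lt with rfl | hlt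
    · exact hsn.ge
    · rw [hsrec κ h2 hlt]
      exact le_max_right _ _
  have minimal : ∀ r, IsPerversity n r → (∀ κ, 2 ≤ κ → κ ≤ n → p κ + q κ ≤ r κ) →
      ∀ κ, 2 ≤ κ → κ ≤ n → s κ ≤ r κ := by
    intro r hr hle κ h2 hκ
    induction hκ using Nat.decreasingInduction with
    | self => exact hsn.le.trans (hle n hn le_rfl)
    | of_succ k hk ih =>
      have hs := ih (by omega)
      have hstep := (hr.2 k h2 hk).2
      rw [hsrec k h2 hk]
      exact max_le (by omega) (hle k h2 hk.le)
  refine ⟨⟨?_, fun κ h2 hκ => ?_⟩, dom, minimal⟩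
  · obtain ⟨r, hr, hle⟩ := h
    exact Nat.le_zero.mp ((minimal r hr hle 2 le_rfl hn).trans hr.1.le)
  · have hp' := (hp.2 κ h2 hκ).1
    have hq' := (hq.2 κ h2 hκ).1
    have hd := dom (κ + 1) (by omega) hκ
    have hs := hsrec κ h2 hκ
    omega
end

section
/- Let n ≥ 2, let p̄ and q̄ be two n-perversities, and let f̄ : {2,…,n} → ℤ≥0 be a non-decreasing function such that there exists an n-perversity r̄ with p̄(κ) + q̄(κ) + f̄(κ) ≤ r̄(κ) for all 2 ≤ κ ≤ n. Let s̄ be the minimal n-perversity over p̄ and q̄, i.e. the minimum among all n-perversities dominating p̄ + q̄ pointwise. Then s̄(κ) + f̄(κ) ≤ r̄(κ) for all 2 ≤ κ ≤ n. -/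
theorem IsPerversity.le_add_sub {n : ℕ} {r : ℕ → ℕ} (hr : IsPerversity n r) {κ j : ℕ}
    (hκ : 2 ≤ κ) (hκj : κ ≤ j) (hj : j ≤ n) : r j ≤ r κ + (j - κ) := by
  induction j, hκj using Nat.le_induction with
  | base => simp
  | succ j hκj ih =>
    have h := (hr.2 j (by omega) hj).2
    have := ih (by omega)
    omega

theorem le_of_le_succ_of_two_le {n : ℕ} {f : ℕ → ℕ}
    (hf : ∀ κ, 2 ≤ κ → κ + 1 ≤ n → f κ ≤ f (κ + 1)) {κ j : ℕ}
    (hκ : 2 ≤ κ) (hκj : κ ≤ j) (hj : j ≤ n) : f κ ≤ f j := by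
  induction j, hκj using Nat.le_induction with
  | base => exact le_rfl
  | succ j hκj ih => exact (ih (by omega)).trans (hf j (by omega) hj)

/-- The least function above `g` on `{κ, …, n}` that grows by at most one at each step. -/
def slopeHull (n : ℕ) (g : ℕ → ℕ) (κ : ℕ) : ℕ :=
  (Finset.Icc κ n).sup fun j => g j - (j - κ)

theorem sub_le_slopeHull {n : ℕ} (g : ℕ → ℕ) {κ j : ℕ} (hκj : κ ≤ j) (hj : j ≤ n) :
    g j - (j - κ) ≤ slopeHull n g κ :=
  Finset.le_sup (f := fun j => g j - (j - κ)) (Finset.mem_Icc.2 ⟨hκj, hj⟩)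

theorem le_slopeHull {n : ℕ} (g : ℕ → ℕ) {κ : ℕ} (hκ : κ ≤ n) : g κ ≤ slopeHull n g κ := by
  simpa using sub_le_slopeHull g le_rfl hκ

theorem slopeHull_le_iff {n : ℕ} {g : ℕ → ℕ} {κ b : ℕ} :
    slopeHull n g κ ≤ b ↔ ∀ j, κ ≤ j → j ≤ n → g j - (j - κ) ≤ b := by
  simp [slopeHull, Finset.sup_le_iff]

theorem slopeHull_add_le {n : ℕ} {g f r : ℕ → ℕ} (hr : IsPerversity n r)
    (hf : ∀ κ, 2 ≤ κ → κ + 1 ≤ n → f κ ≤ f (κ + 1))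
    (hgfr : ∀ κ, 2 ≤ κ → κ ≤ n → g κ + f κ ≤ r κ) {κ : ℕ} (hκ : 2 ≤ κ) (hκn : κ ≤ n) :
    slopeHull n g κ + f κ ≤ r κ := by
  have hfr := hgfr κ hκ hκn
  have : slopeHull n g κ ≤ r κ - f κ := slopeHull_le_iff.2 fun j hκj hj => by
    have h₁ := hr.le_add_sub hκ hκj hj
    have h₂ := le_of_le_succ_of_two_le hf hκ hκj hj
    have h₃ := hgfr j (hκ.trans hκj) hj
    omega
  omega

theorem isPerversity_slopeHull {n : ℕ} {g : ℕ → ℕ}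
    (hg : ∀ κ, 2 ≤ κ → κ + 1 ≤ n → g κ ≤ g (κ + 1)) (h2 : slopeHull n g 2 = 0) :
    IsPerversity n (slopeHull n g) := by
  refine ⟨h2, fun κ hκ hκn => ⟨slopeHull_le_iff.2 fun j hκj hj => ?_,
    slopeHull_le_iff.2 fun j hκj hj => ?_⟩⟩
  · rcases hκj.eq_or_lt with rfl | hlt
    · have h₁ := hg κ hκ hκn
      have h₂ := le_slopeHull g hκn
      omega
    · have := sub_le_slopeHull g (Nat.succ_le_of_lt hlt) hj
      simp only [Nat.succ_eq_add_one] at this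
      omega
  · have := sub_le_slopeHull g (show κ ≤ j by omega) hj
    omega

/-- If `f` is non-decreasing on `{2,…,n}`, `r` is an `n`-perversity with
`p κ + q κ + f κ ≤ r κ` on `{2,…,n}`, and `s` is the minimal `n`-perversity over `p` and `q`,
then `s κ + f κ ≤ r κ` on `{2,…,n}`. -/
theorem minimal_perversity_sum (n : ℕ) (hn : 2 ≤ n) (p q f : ℕ → ℕ)
    (hp : IsPerversity n p) (hq : IsPerversity n q)
    (hf : ∀ κ, 2 ≤ κ → κ + 1 ≤ n → f κ ≤ f (κ + 1))
    (r : ℕ → ℕ) (hr : IsPerversity n r)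
    (hpqfr : ∀ κ, 2 ≤ κ → κ ≤ n → p κ + q κ + f κ ≤ r κ)
    (s : ℕ → ℕ) (hs : IsPerversity n s)
    (hsge : ∀ κ, 2 ≤ κ → κ ≤ n → p κ + q κ ≤ s κ)
    (hsmin : ∀ r', IsPerversity n r' → (∀ κ, 2 ≤ κ → κ ≤ n → p κ + q κ ≤ r' κ) →
      ∀ κ, 2 ≤ κ → κ ≤ n → s κ ≤ r' κ) :
    ∀ κ, 2 ≤ κ → κ ≤ n → s κ + f κ ≤ r κ := by
  have hull_add_le : ∀ κ, 2 ≤ κ → κ ≤ n → slopeHull n (fun κ => p κ + q κ) κ + f κ ≤ r κ :=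
    fun κ hκ hκn => slopeHull_add_le hr hf hpqfr hκ hκn
  have hull_two : slopeHull n (fun κ => p κ + q κ) 2 = 0 := by
    have h₁ := hull_add_le 2 le_rfl hn
    have h₂ := hr.1
    omega
  have hull_perv : IsPerversity n (slopeHull n fun κ => p κ + q κ) :=
    isPerversity_slopeHull
      (fun κ hκ hκn => add_le_add (hp.2 κ hκ hκn).1 (hq.2 κ hκ hκn).1) hull_two
  intro κ hκ hκn
  exact (Nat.add_le_add_right (hsmin _ hull_perv
    (fun j _ hj => le_slopeHull (fun κ => p κ + q κ) hj) κ hκ hκn) _).trans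
      (hull_add_le κ hκ hκn)
end

section
/- Let A and B be torsion-free abelian groups, and let A′ ≤ A and B′ ≤ B be subgroups such that the quotients A/A′ and B/B′ are torsion-free. Let q₁ : A → A/A′ and q₂ : B → B/B′ denote the quotient homomorphisms. Then the natural map A′ ⊗ B′ → A ⊗ B (tensor products over ℤ) induced by the inclusions is injective, and its image equals the intersection of the kernels of q₁ ⊗ id_B : A ⊗ B → (A/A′) ⊗ B and id_A ⊗ q₂ : A ⊗ B → A ⊗ (B/B′); equivalently, it equals the kernel of the map A ⊗ B → ((A/A′) ⊗ B) ⊕ (A ⊗ (B/B′)) given by (q₁ ⊗ id) ⊕ (id ⊗ q₂). -/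
open scoped TensorProduct

/-- An abelian group is torsion-free if its only element of finite order is `0`. -/
def IsTorsionFreeAddGroup (A : Type*) [AddCommGroup A] : Prop :=
  ∀ x : A, (∃ n : ℤ, n ≠ 0 ∧ n • x = 0) → x = 0

namespace TensorProduct

variable {R M N : Type*} [CommRing R] [AddCommGroup M] [AddCommGroup N] [Module R M] [Module R N]

theorem map_subtype_injective_of_flat (M' : Submodule R M) (N' : Submodule R N)
    [Module.Flat R M'] [Module.Flat R N] :
    Function.Injective (map M'.subtype N'.subtype) := by
  rw [← LinearMap.rTensor_comp_lTensor, LinearMap.coe_comp]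
  exact (Module.Flat.rTensor_preserves_injective_linearMap _ M'.injective_subtype).comp
    (Module.Flat.lTensor_preserves_injective_linearMap _ N'.injective_subtype)

theorem range_map_subtype_eq_inf_ker (M' : Submodule R M) (N' : Submodule R N)
    [Module.Flat R (N ⧸ N')] :
    LinearMap.range (map M'.subtype N'.subtype) =
      LinearMap.ker (map M'.mkQ (LinearMap.id : N →ₗ[R] N)) ⊓
        LinearMap.ker (map (LinearMap.id : M →ₗ[R] M) N'.mkQ) := by
  apply le_antisymm
  · rintro _ ⟨t, rfl⟩
    simp only [Submodule.mem_inf, LinearMap.mem_ker, ← LinearMap.comp_apply, ← map_comp]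
    simp [(LinearMap.exact_subtype_mkQ M').linearMap_comp_eq_zero,
      (LinearMap.exact_subtype_mkQ N').linearMap_comp_eq_zero]
  · rintro t ⟨hM, hN⟩
    obtain ⟨s, rfl⟩ := (rTensor_exact N (LinearMap.exact_subtype_mkQ M') M'.mkQ_surjective t).1 hM
    have hs : N'.mkQ.lTensor M' s = 0 := by
      apply Module.Flat.rTensor_preserves_injective_linearMap (M := N ⧸ N') _ M'.injective_subtype
      rw [map_zero, ← LinearMap.comp_apply, LinearMap.rTensor_comp_lTensor,
        ← LinearMap.lTensor_comp_rTensor]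
      exact hN
    obtain ⟨r, rfl⟩ := (lTensor_exact M' (LinearMap.exact_subtype_mkQ N') N'.mkQ_surjective s).1 hs
    exact ⟨r, by rw [← LinearMap.rTensor_comp_lTensor, LinearMap.comp_apply]⟩

end TensorProduct

namespace IsTorsionFreeAddGroup

variable {A : Type*} [AddCommGroup A]

theorem flat [Module ℤ A] (h : IsTorsionFreeAddGroup A) : Module.Flat ℤ A := by
  have : Module.IsTorsionFree ℤ A := .of_smul_eq_zero fun n x hnx =>
    or_iff_not_imp_left.2 fun hn => h x ⟨n, hn, by rwa [← int_smul_eq_zsmul]⟩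
  infer_instance

theorem submodule (h : IsTorsionFreeAddGroup A) (A' : Submodule ℤ A) :
    IsTorsionFreeAddGroup A' :=
  fun x ⟨n, hn, hx⟩ => Subtype.ext (h x ⟨n, hn, congrArg Subtype.val hx⟩)

end IsTorsionFreeAddGroup

/-- For torsion-free abelian groups `A`, `B` and subgroups `A' ≤ A`, `B' ≤ B` with torsion-free
quotients, the natural map `A' ⊗ B' → A ⊗ B` is injective and its image is the intersection of
the kernels of `q₁ ⊗ id` and `id ⊗ q₂`; equivalently, the kernel of `(q₁ ⊗ id) ⊕ (id ⊗ q₂)`. -/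
theorem tensor_subgroups_range_eq_ker (A B : Type) [AddCommGroup A] [AddCommGroup B]
    (hA : IsTorsionFreeAddGroup A) (hB : IsTorsionFreeAddGroup B)
    (A' : Submodule ℤ A) (B' : Submodule ℤ B)
    (hQA : IsTorsionFreeAddGroup (A ⧸ A')) (hQB : IsTorsionFreeAddGroup (B ⧸ B')) :
    Function.Injective (TensorProduct.map A'.subtype B'.subtype) ∧
      LinearMap.range (TensorProduct.map A'.subtype B'.subtype) =
        LinearMap.ker (TensorProduct.map A'.mkQ (LinearMap.id : B →ₗ[ℤ] B)) ⊓
          LinearMap.ker (TensorProduct.map (LinearMap.id : A →ₗ[ℤ] A) B'.mkQ) ∧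
      LinearMap.range (TensorProduct.map A'.subtype B'.subtype) =
        LinearMap.ker ((TensorProduct.map A'.mkQ (LinearMap.id : B →ₗ[ℤ] B)).prod
          (TensorProduct.map (LinearMap.id : A →ₗ[ℤ] A) B'.mkQ)) := by
  have := (hA.submodule A').flat
  have := hB.flat
  have := hQB.flat
  have h := TensorProduct.range_map_subtype_eq_inf_ker A' B'
  exact ⟨TensorProduct.map_subtype_injective_of_flat A' B', h, by rw [LinearMap.ker_prod, h]⟩
end
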